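/- Let h : ZMod n → {1, -1} with n = 4m, m > 1, and suppose all nontrivial circular autocorrelations of h vanish. If m ≤ 10, derive a contradiction; i.e., there is no circulant Hadamard matrix of order 4m for 1 < m ≤ 10. -/

import Mathlib

open Finset
open scoped Classical

/-- `h` is a `±1` vector. -/
def signRow (n : ℕ) (h : ZMod n → ℤ) : Prop := ∀ j, h j = 1 ∨ h j = -1

/-- All nontrivial circular autocorrelations of `h` vanish: `h` is the defining
row of a circulant Hadamard matrix. -/
def hadamardRow (n : ℕ) [NeZero n] (h : ZMod n → ℤ) : Prop :=
  ∀ s : ZMod n, s ≠ 0 → ∑ j : ZMod n, h j * h (j - s) = 0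

/-- `j` is the first index of a maximal (cyclic) constant block of `h`. -/
def isStart (n : ℕ) (h : ZMod n → ℤ) (j : ZMod n) : Prop := h j ≠ h (j - 1)

/-- The length of the maximal constant run of `h` beginning at `j`. -/
noncomputable def blockLen (n : ℕ) (h : ZMod n → ℤ) (j : ZMod n) : ℕ :=
  sInf {k : ℕ | 0 < k ∧ h (j + (k : ZMod n)) ≠ h j}

/-- `j` is (the position of) a block of size exactly 1. -/
def oneBlock (n : ℕ) (h : ZMod n → ℤ) (j : ZMod n) : Prop :=
  h j ≠ h (j - 1) ∧ h j ≠ h (j + 1)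

/-- `j` starts a block of size exactly 2. -/
def twoBlock (n : ℕ) (h : ZMod n → ℤ) (j : ZMod n) : Prop :=
  h j ≠ h (j - 1) ∧ h j = h (j + 1) ∧ h (j + 1) ≠ h (j + 2)

/-- `j` starts a block of size at least 3. -/
def bigBlock (n : ℕ) (h : ZMod n → ℤ) (j : ZMod n) : Prop :=
  h j ≠ h (j - 1) ∧ h j = h (j + 1) ∧ h (j + 1) = h (j + 2)

/-- The block ending at `j - 1` has size exactly 2. -/
def prevTwo (n : ℕ) (h : ZMod n → ℤ) (j : ZMod n) : Prop :=
  h (j - 1) = h (j - 2) ∧ h (j - 2) ≠ h (j - 3)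

/-- The block ending at `j - 1` has size at least 3. -/
def prevBig (n : ℕ) (h : ZMod n → ℤ) (j : ZMod n) : Prop :=
  h (j - 1) = h (j - 2) ∧ h (j - 2) = h (j - 3)

/-- `j` is the first 1-block of a maximal run of consecutive 1-blocks
(a `1`-alternating sequence). -/
def oneRunStart (n : ℕ) (h : ZMod n → ℤ) (j : ZMod n) : Prop :=
  oneBlock n h j ∧ ¬ oneBlock n h (j - 1)

/-- `j` starts the first 2-block of a maximal run of consecutive 2-blocks
(a `2`-alternating sequence). -/
def twoRunStart (n : ℕ) (h : ZMod n → ℤ) (j : ZMod n) : Prop :=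
  twoBlock n h j ∧ ¬ twoBlock n h (j - 2)

/-- `j` starts the first block of a maximal run of consecutive blocks of size `≥ 3`. -/
def bigRunStart (n : ℕ) (h : ZMod n → ℤ) (j : ZMod n) : Prop :=
  bigBlock n h j ∧ ¬ prevBig n h j

/-- The number `α₁` of maximal runs of consecutive 1-blocks. -/
noncomputable def alpha1 (n : ℕ) [NeZero n] (h : ZMod n → ℤ) : ℕ :=
  (Finset.univ.filter fun j => oneRunStart n h j).card

/-- The length (number of 1-blocks) of the maximal run of 1-blocks starting at `j`. -/
noncomputable def oneRunLen (n : ℕ) (h : ZMod n → ℤ) (j : ZMod n) : ℕ :=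
  sInf {l : ℕ | 0 < l ∧ ¬ oneBlock n h (j + (l : ZMod n))}

/-- The length (number of 2-blocks) of the maximal run of 2-blocks starting at `j`. -/
noncomputable def twoRunLen (n : ℕ) (h : ZMod n → ℤ) (j : ZMod n) : ℕ :=
  sInf {l : ℕ | 0 < l ∧ ¬ twoBlock n h (j + ((2 * l : ℕ) : ZMod n))}


open Polynomial

theorem signRow.mul_self {n : ℕ} {h : ZMod n → ℤ} (hs : signRow n h) (j : ZMod n) :
    h j * h j = 1 := by
  rcases hs j with hj | hj <;> simp [hj]

/-- The values of a character and of its inverse at a circulant Hadamard row multiply to `n`. -/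
theorem hadamardRow.sum_mul_sum {n : ℕ} [NeZero n] {h : ZMod n → ℤ} (hs : signRow n h)
    (hH : hadamardRow n h) {R : Type*} [CommRing R] (e : AddChar (ZMod n) R) :
    (∑ j, (h j : R) * e j) * ∑ j, (h j : R) * e (-j) = n := by
  calc (∑ j, (h j : R) * e j) * ∑ j, (h j : R) * e (-j)
      = ∑ j, ∑ k, ((h j * h k : ℤ) : R) * e (j - k) := by
        rw [Finset.sum_mul_sum]
        refine Finset.sum_congr rfl fun j _ => Finset.sum_congr rfl fun k _ => ?_
        rw [sub_eq_add_neg, AddChar.map_add_eq_mul]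
        push_cast
        ring
    _ = ∑ j, ∑ s, ((h j * h (j - s) : ℤ) : R) * e s := by
        refine Finset.sum_congr rfl fun j _ => ?_
        refine (Equiv.sum_comp (Equiv.subLeft j) _).symm.trans ?_
        simp
    _ = ∑ s, ((∑ j, h j * h (j - s) : ℤ) : R) * e s := by
        rw [Finset.sum_comm]
        simp only [Int.cast_sum, Finset.sum_mul]
    _ = n := by
        rw [Finset.sum_eq_single 0]
        · simp [hs.mul_self, ZMod.card]
        · intro s _ hs0
          rw [hH s hs0, Int.cast_zero, zero_mul]
        · simp

theorem hadamardRow.sq_sum {n : ℕ} [NeZero n] {h : ZMod n → ℤ} (hs : signRow n h)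
    (hH : hadamardRow n h) : (∑ j, h j) ^ 2 = n := by
  simpa [sq] using hH.sum_mul_sum hs (1 : AddChar (ZMod n) ℤ)

/-- If a prime `π` is associated to its image under an involution `σ`, then the `π`-adic
valuation of `y * σ y` is twice that of `y`. -/
theorem Prime.pow_dvd_of_pow_dvd_mul_involutive {R : Type*} [CommRing R] [IsDomain R]
    {σ : R →+* R} (hσ : ∀ x, σ (σ x) = x) {π : R} (hπ : Prime π) (hσπ : Associated π (σ π))
    (k : ℕ) {y : R} (hy : π ^ (2 * k) ∣ y * σ y) : π ^ k ∣ y := by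
  induction k generalizing y with
  | zero => simp
  | succ k ih =>
    have hdvd : π ∣ y := by
      rcases hπ.dvd_or_dvd ((dvd_pow_self π (by omega)).trans hy) with h | h
      · exact h
      · have := map_dvd σ h
        rw [hσ] at this
        exact hσπ.dvd.trans this
    obtain ⟨z, rfl⟩ := hdvd
    obtain ⟨u, hu⟩ := hσπ
    have hz : π ^ (2 * k) ∣ z * σ z := by
      have h2 : π ^ 2 * π ^ (2 * k) ∣ π ^ 2 * (↑u * (z * σ z)) := by
        convert hy using 1
        · ring
        · rw [map_mul, ← hu]
          ring
      have := (mul_dvd_mul_iff_left (pow_ne_zero 2 hπ.ne_zero)).1 h2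
      rwa [Units.dvd_mul_left] at this
    rw [pow_succ']
    exact mul_dvd_mul_left π (ih hz)

theorem AdjoinRoot.dvd_coeff_of_natCast_dvd_mk {f c : ℤ[X]} (hf : f.Monic)
    (hc : c.degree < f.degree) {d : ℕ} (h : (d : AdjoinRoot f) ∣ AdjoinRoot.mk f c) (i : ℕ) :
    (d : ℤ) ∣ c.coeff i := by
  obtain ⟨z, hz⟩ := h
  obtain ⟨q, rfl⟩ := AdjoinRoot.mk_surjective z
  have h1 : AdjoinRoot.mk f c = AdjoinRoot.mk f ((d : ℤ[X]) * q) := by simpa using hz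
  have h2 : c = ((d : ℤ[X]) * q) %ₘ f := by
    rw [← (modByMonic_eq_self_iff hf).2 hc, ← sub_eq_zero, ← sub_modByMonic]
    exact (modByMonic_eq_zero_iff_dvd hf).2 (AdjoinRoot.mk_eq_mk.1 h1)
  have h3 : ((d : ℤ[X]) * q) %ₘ f = (d : ℤ) • (q %ₘ f) := by
    rw [← smul_modByMonic]
    simp
  rw [h2, h3, coeff_smul]
  exact dvd_mul_right _ _

theorem sum_C_mul_X_pow_coeff {N : ℕ} (b : ℕ → ℤ) {i : ℕ} (hi : i < N) :
    (∑ k ∈ Finset.range N, C (b k) * X ^ k).coeff i = b i := by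
  simp [coeff_X_pow, hi]

theorem degree_sum_C_mul_X_pow_lt (N : ℕ) (b : ℕ → ℤ) :
    (∑ k ∈ Finset.range N, C (b k) * X ^ k).degree < (N : WithBot ℕ) := by
  refine (degree_sum_le _ _).trans_lt ((Finset.sup_lt_iff (WithBot.bot_lt_coe N)).2 fun k hk => ?_)
  exact (degree_C_mul_X_pow_le k (b k)).trans_lt (WithBot.coe_lt_coe.2 (Finset.mem_range.1 hk))

theorem AdjoinRoot.natCast_ne_zero {f : ℤ[X]} (hdeg : f.degree ≠ 0) {d : ℕ}
    (hd : d ≠ 0) : (d : AdjoinRoot f) ≠ 0 := by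
  have := AdjoinRoot.of.injective_of_degree_ne_zero (f := f) hdeg
  intro h
  exact hd (by exact_mod_cast (map_eq_zero_iff _ this).1 (by simpa using h : AdjoinRoot.of f d = 0))

/-- A ring hom out of a quotient of `ℤ[X]` into a domain whose kernel is generated by `π`
exhibits `π` as prime. -/
theorem prime_of_ker {R K : Type*} [CommRing R] [CommRing K] [IsDomain K] (ψ : R →+* K) {π : R}
    (hπ : π ≠ 0) (h0 : ψ π = 0) (h : ∀ x, ψ x = 0 → π ∣ x) : Prime π := by
  rw [← Ideal.span_singleton_prime hπ]
  have : Ideal.span {π} = RingHom.ker ψ := by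
    ext x
    rw [Ideal.mem_span_singleton, RingHom.mem_ker]
    exact ⟨fun ⟨y, hy⟩ => by rw [hy, map_mul, h0, zero_mul], h x⟩
  rw [this]
  exact RingHom.ker_isPrime ψ

theorem ZMod.sum_eq_sum_range {n : ℕ} [NeZero n] {M : Type*} [AddCommMonoid M] (F : ZMod n → M) :
    ∑ j, F j = ∑ k ∈ Finset.range n, F k := by
  refine Finset.sum_bij' (fun j _ => j.val) (fun k _ => (k : ZMod n)) ?_ ?_ ?_ ?_ ?_
  · intro j _
    exact Finset.mem_range.2 j.val_lt
  · simp
  · simp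
  · intro k hk
    exact ZMod.val_cast_of_lt (Finset.mem_range.1 hk)
  · simp

/-- If `π` is a prime associated to its conjugate, then the character sum of a circulant Hadamard
row is divisible by any integer `d` which is an associate of a power of `π` with `d * d ∣ n`. -/
theorem hadamardRow.natCast_dvd_sum {n : ℕ} [NeZero n] {h : ZMod n → ℤ} (hs : signRow n h)
    (hH : hadamardRow n h) {R : Type*} [CommRing R] [IsDomain R] {ζ : R} (hζ : ζ ^ n = 1)
    {σ : R →+* R} (hσ : ∀ x, σ (σ x) = x) (hσζ : ζ * σ ζ = 1) {π : R} (hπ : Prime π)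
    (hσπ : Associated π (σ π)) {k d : ℕ} (hd : Associated (π ^ k) (d : R)) (hdn : d * d ∣ n) :
    (d : R) ∣ ∑ i ∈ Finset.range n, (h (i : ZMod n) : R) * ζ ^ i := by
  set e := AddChar.zmodChar n hζ with he
  have hsum : ∑ i ∈ Finset.range n, (h (i : ZMod n) : R) * ζ ^ i = ∑ j, (h j : R) * e j := by
    rw [ZMod.sum_eq_sum_range]
    simp [he, AddChar.zmodChar_apply']
  have hinv (j : ZMod n) : σ (e j) = e (-j) := by
    have h1 : e j * σ (e j) = 1 := by
      rw [he, AddChar.zmodChar_apply, map_pow, ← mul_pow, hσζ, one_pow]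
    have h2 : e j * e (-j) = 1 := by
      rw [← AddChar.map_add_eq_mul, add_neg_cancel, AddChar.map_zero_eq_one]
    exact mul_left_cancel₀ (left_ne_zero_of_mul_eq_one h1) (h1.trans h2.symm)
  rw [hsum, ← hd.dvd_iff_dvd_left]
  apply hπ.pow_dvd_of_pow_dvd_mul_involutive hσ hσπ
  rw [map_sum]
  simp only [map_mul, map_intCast, hinv]
  rw [hH.sum_mul_sum hs, two_mul, pow_add]
  refine (mul_dvd_mul hd.dvd hd.dvd).trans ?_
  exact_mod_cast Nat.cast_dvd_cast (α := R) hdn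

theorem hadamardRow.sum_ne_zero {n : ℕ} [NeZero n] {h : ZMod n → ℤ} (hs : signRow n h)
    (hH : hadamardRow n h) {R : Type*} [CommRing R] {ζ : R} (hζ : ζ ^ n = 1) (hn : (n : R) ≠ 0) :
    ∑ i ∈ Finset.range n, (h (i : ZMod n) : R) * ζ ^ i ≠ 0 := by
  intro h0
  apply hn
  rw [← hH.sum_mul_sum hs (AddChar.zmodChar n hζ), ZMod.sum_eq_sum_range]
  simp [AddChar.zmodChar_apply', h0]

/-- If `f` vanishes at the inverse of its root, `ℤ[X] / (f)` has an involution inverting the root. -/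
theorem AdjoinRoot.exists_involutive {f : ℤ[X]} {ξ : AdjoinRoot f}
    (hξ : AdjoinRoot.root f * ξ = 1) (hf : f.eval₂ (AdjoinRoot.of f) ξ = 0) :
    ∃ σ : AdjoinRoot f →+* AdjoinRoot f,
      (∀ x, σ (σ x) = x) ∧ σ (AdjoinRoot.root f) = ξ := by
  have hr : AdjoinRoot.lift (AdjoinRoot.of f) ξ hf (AdjoinRoot.root f) = ξ :=
    AdjoinRoot.lift_root hf
  refine ⟨AdjoinRoot.lift (AdjoinRoot.of f) ξ hf, fun x => ?_, hr⟩
  set σ := AdjoinRoot.lift (AdjoinRoot.of f) ξ hf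
  have h1 : σ ξ * ξ = 1 := by
    rw [← hr, ← map_mul, mul_comm, hr, hξ, map_one]
  have : σ.comp σ = RingHom.id _ := by
    apply AdjoinRoot.ringHom_ext
    · exact RingHom.ext_int _ _
    · rw [RingHom.comp_apply, hr, RingHom.id_apply]
      calc σ ξ = σ ξ * (AdjoinRoot.root f * ξ) := by rw [hξ, mul_one]
        _ = (σ ξ * ξ) * AdjoinRoot.root f := by ring
        _ = _ := by rw [h1, one_mul]
  exact congrArg (fun g => g x) this

theorem irreducible_X_pow_eight_add_one : Irreducible (X ^ 8 + 1 : ℤ[X]) := by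
  have := cyclotomic_prime_pow_eq_geom_sum (R := ℤ) (n := 3) Nat.prime_two
  rw [show (X ^ 8 + 1 : ℤ[X]) = cyclotomic 16 ℤ by
    norm_num [Finset.sum_range_succ] at this
    rw [this]
    ring]
  exact cyclotomic.irreducible (by norm_num)

theorem irreducible_X_pow_twelve_sub : Irreducible (X ^ 12 - X ^ 6 + 1 : ℤ[X]) := by
  have h12 := cyclotomic_expand_eq_cyclotomic (p := 2) (n := 6) Nat.prime_two (by norm_num) ℤ
  have h36 := cyclotomic_expand_eq_cyclotomic (p := 3) (n := 12) Nat.prime_three (by norm_num) ℤ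
  rw [show (X ^ 12 - X ^ 6 + 1 : ℤ[X]) = cyclotomic 36 ℤ by
    norm_num only at h12 h36
    rw [← h36, ← h12, cyclotomic_six]
    simp
    ring]
  exact cyclotomic.irreducible (by norm_num)

theorem not_hadamardRow_sixteen (h : ZMod 16 → ℤ) (hs : signRow 16 h) : ¬ hadamardRow 16 h := by
  intro hH
  set f : ℤ[X] := X ^ 8 + 1 with hf
  have hmonic : f.Monic := by rw [hf]; monicity!
  have hdeg : f.degree = 8 := by rw [hf]; compute_degree!
  have : Fact (Prime f) := ⟨irreducible_X_pow_eight_add_one.prime⟩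
  have : IsDomain (AdjoinRoot f) := AdjoinRoot.isDomain_of_prime Fact.out
  set ζ := AdjoinRoot.root f with hζdef
  have hrel : ζ ^ 8 + 1 = 0 := by
    simpa [hf] using AdjoinRoot.mk_self (f := f)
  have hζ : ζ ^ 16 = 1 := by linear_combination (ζ ^ 8 - 1) * hrel
  have hinv : ζ * ζ ^ 15 = 1 := by rw [← hζ]; ring
  obtain ⟨σ, hσ, hσζ⟩ := AdjoinRoot.exists_involutive (f := f) hinv (by
    simp only [hf, eval₂_add, eval₂_pow, eval₂_X, eval₂_one]
    linear_combination (ζ ^ 112 - ζ ^ 104 + ζ ^ 96 - ζ ^ 88 + ζ ^ 80 - ζ ^ 72 + ζ ^ 64 - ζ ^ 56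
      + ζ ^ 48 - ζ ^ 40 + ζ ^ 32 - ζ ^ 24 + ζ ^ 16 - ζ ^ 8 + 1) * hrel)
  change σ ζ = ζ ^ 15 at hσζ
  have h8 : Associated ((ζ - 1) ^ 8) ((2 : ℕ) : AdjoinRoot f) := by
    apply associated_of_dvd_dvd
    · refine ⟨-356 * ζ - 658 * ζ ^ 2 - 860 * ζ ^ 3 - 931 * ζ ^ 4 - 860 * ζ ^ 5 - 658 * ζ ^ 6
        - 356 * ζ ^ 7, ?_⟩
      push_cast
      linear_combination (2 + 356 * ζ - 2190 * ζ ^ 2 + 5564 * ζ ^ 3 - 7461 * ζ ^ 4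
        + 5564 * ζ ^ 5 - 2190 * ζ ^ 6 + 356 * ζ ^ 7) * hrel
    · refine ⟨-4 * ζ + 14 * ζ ^ 2 - 28 * ζ ^ 3 + 35 * ζ ^ 4 - 28 * ζ ^ 5 + 14 * ζ ^ 6
        - 4 * ζ ^ 7, ?_⟩
      push_cast
      linear_combination hrel
  have h2 : ζ - 1 ∣ 2 := (dvd_pow_self _ (show 8 ≠ 0 by norm_num)).trans (by simpa using h8.dvd)
  have hπ : Prime (ζ - 1) := by
    refine prime_of_ker (AdjoinRoot.lift (Int.castRingHom (ZMod 2)) 1 (by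
      simp [hf, eval₂_add]; decide)) ?_ (by simp [hζdef]) ?_
    · intro h0
      rw [h0, zero_dvd_iff] at h2
      exact AdjoinRoot.natCast_ne_zero (f := f) (d := 2) (by simp [hdeg]) two_ne_zero (by exact_mod_cast h2)
    · intro x hx
      obtain ⟨p, rfl⟩ := AdjoinRoot.mk_surjective x
      have hev : ((p.eval 1 : ℤ) : ZMod 2) = 0 := by
        rw [AdjoinRoot.lift_mk] at hx
        rw [← hx, ← eq_intCast (Int.castRingHom (ZMod 2)), ← eval₂_at_one]
      obtain ⟨t, ht⟩ := (ZMod.intCast_zmod_eq_zero_iff_dvd _ 2).1 hev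
      obtain ⟨q, hq⟩ := X_sub_C_dvd_sub_C_eval (a := 1) (p := p)
      have hp : AdjoinRoot.mk f p = (ζ - 1) * AdjoinRoot.mk f q + 2 * (t : AdjoinRoot f) := by
        rw [eq_add_of_sub_eq hq, ht]
        simp only [map_add, map_mul, map_sub, map_one, AdjoinRoot.mk_C, AdjoinRoot.mk_X]
        push_cast
        rfl
      rw [hp]
      exact dvd_add (dvd_mul_right _ _) (h2.mul_right _)
  have hσπ : Associated (ζ - 1) (σ (ζ - 1)) := by
    refine ⟨-Units.mkOfMulEqOne _ _ hinv ^ 15, ?_⟩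
    simp [hσζ]
    linear_combination (-1 : AdjoinRoot f) * hζ
  have h4 : Associated ((ζ - 1) ^ 16) ((4 : ℕ) : AdjoinRoot f) := by
    rw [show (ζ - 1) ^ 16 = (ζ - 1) ^ 8 * (ζ - 1) ^ 8 by ring,
      show ((4 : ℕ) : AdjoinRoot f) = (2 : ℕ) * (2 : ℕ) by norm_num]
    exact h8.mul_mul h8
  have hdvd := hH.natCast_dvd_sum hs hζ hσ (by rw [hσζ]; exact hinv) hπ hσπ h4 (by norm_num)
  have hne := hH.sum_ne_zero hs hζ (AdjoinRoot.natCast_ne_zero (by simp [hdeg]) (by norm_num))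
  set a : ℕ → ℤ := fun i => h (i : ZMod 16) with ha
  have hsa (i : ℕ) : a i = 1 ∨ a i = -1 := hs _
  set b : ℕ → ℤ := fun i => a i - a (8 + i) with hb
  have hmk : ∑ i ∈ Finset.range 16, (h (i : ZMod 16) : AdjoinRoot f) * ζ ^ i =
      AdjoinRoot.mk f (∑ i ∈ Finset.range 8, C (b i) * X ^ i) := by
    change ∑ i ∈ Finset.range 16, (a i : AdjoinRoot f) * ζ ^ i = _
    rw [Finset.sum_range_add (n := 8) (m := 8), map_sum, ← Finset.sum_add_distrib]
    refine Finset.sum_congr rfl fun i _ => ?_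
    simp [hb, ← hζdef]
    linear_combination (a (8 + i) * ζ ^ i : AdjoinRoot f) * hrel
  rw [hmk] at hdvd hne
  refine hne ?_
  rw [Finset.sum_eq_zero, map_zero]
  intro i hi
  have h4i := AdjoinRoot.dvd_coeff_of_natCast_dvd_mk hmonic
    (by rw [hdeg]; exact degree_sum_C_mul_X_pow_lt 8 b) hdvd i
  rw [sum_C_mul_X_pow_coeff b (Finset.mem_range.1 hi)] at h4i
  have : b i = 0 := by
    have h1 := hsa i
    have h2 := hsa (8 + i)
    simp only [hb] at h4i ⊢
    omega
  simp [this]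

theorem not_hadamardRow_thirtySix (h : ZMod 36 → ℤ) (hs : signRow 36 h) :
    ¬ hadamardRow 36 h := by
  intro hH
  set f : ℤ[X] := X ^ 12 - X ^ 6 + 1 with hf
  have hmonic : f.Monic := by rw [hf]; monicity!
  have hdeg : f.degree = 12 := by rw [hf]; compute_degree!
  have : Fact (Prime f) := ⟨irreducible_X_pow_twelve_sub.prime⟩
  have : IsDomain (AdjoinRoot f) := AdjoinRoot.isDomain_of_prime Fact.out
  set ζ := AdjoinRoot.root f with hζdef
  have hrel : ζ ^ 12 - ζ ^ 6 + 1 = 0 := by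
    simpa [hf] using AdjoinRoot.mk_self (f := f)
  have h18 : ζ ^ 18 = -1 := by linear_combination (ζ ^ 6 + 1) * hrel
  have hζ : ζ ^ 36 = 1 := by linear_combination (ζ ^ 18 - 1) * h18
  have hinv : ζ * ζ ^ 35 = 1 := by rw [← hζ]; ring
  obtain ⟨σ, hσ, hσζ⟩ := AdjoinRoot.exists_involutive (f := f) hinv (by
    simp only [hf, eval₂_add, eval₂_sub, eval₂_pow, eval₂_X, eval₂_one]
    have h210 : (ζ ^ 35) ^ 6 = -ζ ^ 12 := by
      calc (ζ ^ 35) ^ 6 = (ζ ^ 18) ^ 11 * ζ ^ 12 := by ring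
        _ = -ζ ^ 12 := by rw [h18]; ring
    have h420 : (ζ ^ 35) ^ 12 = -ζ ^ 6 := by
      calc (ζ ^ 35) ^ 12 = (ζ ^ 18) ^ 23 * ζ ^ 6 := by ring
        _ = -ζ ^ 6 := by rw [h18]; ring
    rw [h210, h420]
    linear_combination hrel)
  change σ ζ = ζ ^ 35 at hσζ
  have h6 : Associated ((ζ ^ 2 + 1) ^ 6) ((3 : ℕ) : AdjoinRoot f) := by
    apply associated_of_dvd_dvd
    · refine ⟨10 - 11 * ζ ^ 2 + 7 * ζ ^ 4 - 10 * ζ ^ 6 + 4 * ζ ^ 8 + 4 * ζ ^ 10, ?_⟩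
      push_cast
      linear_combination -(7 + 49 * ζ ^ 2 + 91 * ζ ^ 4 + 74 * ζ ^ 6 + 28 * ζ ^ 8
        + 4 * ζ ^ 10) * hrel
    · refine ⟨2 * ζ ^ 2 + 5 * ζ ^ 4 + 7 * ζ ^ 6 + 5 * ζ ^ 8 + 2 * ζ ^ 10, ?_⟩
      push_cast
      linear_combination hrel
  have h3 : ζ ^ 2 + 1 ∣ 3 := (dvd_pow_self _ (show 6 ≠ 0 by norm_num)).trans (by simpa using h6.dvd)
  have hπ : Prime (ζ ^ 2 + 1) := by
    have : Fact (Nat.Prime 3) := ⟨Nat.prime_three⟩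
    have hprime : Prime ((3 : ℕ) : GaussianInt) :=
      GaussianInt.prime_of_nat_prime_of_mod_four_eq_three 3 (by norm_num)
    set I : Ideal GaussianInt := Ideal.span {((3 : ℕ) : GaussianInt)} with hI
    have : I.IsPrime := (Ideal.span_singleton_prime hprime.ne_zero).2 hprime
    have h3I : (3 : GaussianInt ⧸ I) = 0 := by
      exact_mod_cast Ideal.Quotient.eq_zero_iff_mem.2
        (Ideal.mem_span_singleton_self ((3 : ℕ) : GaussianInt))
    set w : GaussianInt := ⟨0, 1⟩ with hw
    have hw2 : w ^ 2 = -1 := by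
      rw [sq]
      ext <;> simp [hw]
    have hw2' : (Ideal.Quotient.mk I w) ^ 2 = -1 := by rw [← map_pow, hw2]; simp
    set w' := Ideal.Quotient.mk I w with hw'
    set ι := Int.castRingHom (GaussianInt ⧸ I)
    have hlift : f.eval₂ ι w' = 0 := by
      simp only [hf, eval₂_add, eval₂_sub, eval₂_pow, eval₂_X, eval₂_one]
      linear_combination (w' ^ 10 - w' ^ 8 + w' ^ 6 - 2 * w' ^ 4 + 2 * w' ^ 2 - 2) * hw2' + h3I
    refine prime_of_ker (AdjoinRoot.lift ι w' hlift) ?_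
      (by simp [hζdef, hw2']) ?_
    · intro h0
      rw [h0, zero_dvd_iff] at h3
      exact AdjoinRoot.natCast_ne_zero (f := f) (d := 3) (by simp [hdeg]) three_ne_zero (by exact_mod_cast h3)
    · intro x hx
      obtain ⟨p, rfl⟩ := AdjoinRoot.mk_surjective x
      have hg : (X ^ 2 + 1 : ℤ[X]).Monic := by monicity!
      have hgdeg : (X ^ 2 + 1 : ℤ[X]).degree = 2 := by compute_degree!
      have hlin := eq_X_add_C_of_degree_le_one (p := p %ₘ (X ^ 2 + 1)) (by
        have := degree_modByMonic_lt p hg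
        rw [hgdeg] at this
        exact Order.le_of_lt_succ this)
      have hp := modByMonic_add_div p (X ^ 2 + 1 : ℤ[X])
      generalize p /ₘ (X ^ 2 + 1) = q at hp
      generalize (p %ₘ (X ^ 2 + 1)).coeff 0 = r₀ at hlin
      generalize (p %ₘ (X ^ 2 + 1)).coeff 1 = r₁ at hlin
      rw [hlin] at hp
      have hr : Ideal.Quotient.mk I ⟨r₀, r₁⟩ = 0 := by
        rw [AdjoinRoot.lift_mk, ← hp] at hx
        simp only [eval₂_add, eval₂_mul, eval₂_pow, eval₂_X, eval₂_one, eval₂_C, hw2'] at hx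
        rw [← hx, show (⟨r₀, r₁⟩ : GaussianInt) = r₁ * w + r₀ by ext <;> simp [hw]]
        simp [ι, hw']
      rw [Ideal.Quotient.eq_zero_iff_mem, hI, Ideal.mem_span_singleton] at hr
      obtain ⟨⟨s₀, hs₀⟩, s₁, hs₁⟩ := (Zsqrtd.intCast_dvd 3 _).1 (by exact_mod_cast hr)
      have hp' : AdjoinRoot.mk f p =
          (ζ ^ 2 + 1) * AdjoinRoot.mk f q + 3 * ((s₁ : AdjoinRoot f) * ζ + s₀) := by
        simp only at hs₀ hs₁
        rw [← hp, hs₀, hs₁]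
        simp only [map_add, map_mul, map_pow, map_one, AdjoinRoot.mk_X, ← hζdef, eq_intCast, map_intCast,
          map_ofNat]
        ring
      rw [hp']
      exact dvd_add (dvd_mul_right _ _) (h3.mul_right _)
  have hσπ : Associated (ζ ^ 2 + 1) (σ (ζ ^ 2 + 1)) := by
    refine ⟨Units.mkOfMulEqOne _ _ hinv ^ 34, ?_⟩
    simp [hσζ]
    linear_combination (1 - ζ ^ 34) * hζ
  have hdvd := hH.natCast_dvd_sum hs hζ hσ (by rw [hσζ]; exact hinv) hπ hσπ h6 (by norm_num)
  have hne := hH.sum_ne_zero hs hζ (AdjoinRoot.natCast_ne_zero (by simp [hdeg]) (by norm_num))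
  set a : ℕ → ℤ := fun i => h (i : ZMod 36) with ha
  have hsa (i : ℕ) : a i = 1 ∨ a i = -1 := hs _
  set b : ℕ → ℤ := fun i => if i < 6 then a i - a (18 + i) - a (12 + i) + a (30 + i)
    else a i - a (18 + i) + a (6 + i) - a (24 + i) with hb
  have hmk : ∑ i ∈ Finset.range 36, (h (i : ZMod 36) : AdjoinRoot f) * ζ ^ i =
      AdjoinRoot.mk f (∑ i ∈ Finset.range 12, C (b i) * X ^ i) := by
    change ∑ i ∈ Finset.range 36, (a i : AdjoinRoot f) * ζ ^ i = _
    rw [show 36 = 6 + 6 + 6 + 6 + 6 + 6 by rfl, show 12 = 6 + 6 by rfl]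
    simp only [Finset.sum_range_add, map_sum, map_add, ← Finset.sum_add_distrib]
    refine Finset.sum_congr rfl fun i hi => ?_
    have hb0 : b i = a i - a (18 + i) - a (12 + i) + a (30 + i) :=
      if_pos (Finset.mem_range.1 hi)
    have hb1 : b (6 + i) = a (6 + i) - a (24 + i) + a (12 + i) - a (30 + i) := by
      simp only [hb, if_neg (show ¬ 6 + i < 6 by omega)]
      ring_nf
    rw [hb0, hb1]
    simp [← hζdef]
    linear_combination ζ ^ i * ((a (12 + i) : AdjoinRoot f) + (ζ ^ 6 + 1) * (a (18 + i)
      + a (24 + i) * ζ ^ 6) + (ζ ^ 18 + ζ ^ 12 - 1) * a (30 + i)) * hrel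
  rw [hmk] at hdvd hne
  refine hne ?_
  rw [Finset.sum_eq_zero, map_zero]
  intro i hi
  have h3i := AdjoinRoot.dvd_coeff_of_natCast_dvd_mk hmonic
    (by rw [hdeg]; exact degree_sum_C_mul_X_pow_lt 12 b) hdvd i
  rw [sum_C_mul_X_pow_coeff b (Finset.mem_range.1 hi)] at h3i
  have : b i = 0 := by
    have h0 := hsa i
    have h1 := hsa (6 + i)
    have h2 := hsa (12 + i)
    have h3 := hsa (18 + i)
    have h4 := hsa (24 + i)
    have h5 := hsa (30 + i)
    simp only [hb] at h3i ⊢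
    split_ifs at h3i ⊢ <;> omega
  simp [this]

theorem stmt17 (n m : ℕ) [NeZero n] (h : ZMod n → ℤ)
    (hn : n = 4 * m) (hm : 1 < m) (hm10 : m ≤ 10)
    (hsign : signRow n h) (hH : hadamardRow n h) : False := by
  have hsq := hH.sq_sum hsign
  generalize ∑ j, h j = S at hsq
  obtain ⟨s, hs⟩ : ∃ s : ℕ, s ^ 2 = n := ⟨S.natAbs, by zify; simpa using hsq⟩
  have hlt : s < 7 := by nlinarith
  have hcases : n = 16 ∨ n = 36 := by
    interval_cases s <;> omega
  rcases hcases with rfl | rfl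
  · exact not_hadamardRow_sixteen h hsign hH
  · exact not_hadamardRow_thirtySix h hsign hH
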